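/- The blockwise normalization of the rule 150 total activity is a Lucas-type combination of Fibonacci numbers: for every n ≥ 1, S(n) − S(n−1) = 2^(n−1) · (fib(n+2) + fib(n)); equivalently the per-site block mean N(n) = (S(n) − S(n−1)) / 2^(n−1) equals 2·fib(n+2) − fib(n+1), whose first values are 1, 3, 4, 7, 11, 18, …. -/

import Mathlib

/-- Rule 150 elementary cellular automaton, started from a single seed at the origin. -/
def rule150 : ℕ → ℤ → ZMod 2
  | 0, n => if n = 0 then 1 else 0
  | t + 1, n => rule150 t (n - 1) + rule150 t n + rule150 t (n + 1)

/-- Total activity: the number of active sites at time `t`. -/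
noncomputable def totalActivity (t : ℕ) : ℕ := {n : ℤ | rule150 t n = 1}.ncard

/-- Block sum of the total activity over the first `2 ^ n` time steps. -/
noncomputable def blockSum (n : ℕ) : ℕ := ∑ i ∈ Finset.range (2 ^ n), totalActivity i

theorem rule150_eq_zero_of_lt_abs (t : ℕ) (n : ℤ) (h : (t : ℤ) < |n|) : rule150 t n = 0 := by
  induction t generalizing n with
  | zero =>
    have : n ≠ 0 := by
      rintro rfl
      simp at h
    simp [rule150, this]
  | succ t ih =>
    push_cast at h
    rw [lt_abs] at h
    simp only [rule150]
    rw [ih (n - 1) (by rw [lt_abs]; omega), ih n (by rw [lt_abs]; omega),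
      ih (n + 1) (by rw [lt_abs]; omega)]
    simp

theorem rule150_add_two (t : ℕ) (n : ℤ) :
    rule150 (t + 2) n = rule150 t (n - 2) + rule150 t n + rule150 t (n + 2) := by
  simp only [rule150]
  rw [show n - 1 - 1 = n - 2 by ring, show n - 1 + 1 = n by ring,
    show n + 1 - 1 = n by ring, show n + 1 + 1 = n + 2 by ring]
  generalize rule150 t (n - 2) = a, rule150 t (n - 1) = b, rule150 t n = c,
    rule150 t (n + 1) = d, rule150 t (n + 2) = e
  decide +revert

theorem rule150_two_mul (t : ℕ) (k : ℤ) :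
    rule150 (2 * t) (2 * k) = rule150 t k ∧ rule150 (2 * t) (2 * k + 1) = 0 := by
  induction t generalizing k with
  | zero =>
    have : 2 * k + 1 ≠ 0 := by omega
    simp [rule150, this]
  | succ t ih =>
    rw [show 2 * (t + 1) = 2 * t + 2 by ring, rule150_add_two, rule150_add_two,
      show 2 * k - 2 = 2 * (k - 1) by ring, show 2 * k + 2 = 2 * (k + 1) by ring,
      show 2 * k + 1 - 2 = 2 * (k - 1) + 1 by ring,
      show 2 * k + 1 + 2 = 2 * (k + 1) + 1 by ring]
    simp [ih, rule150]

theorem rule150_two_mul_even (t : ℕ) (k : ℤ) : rule150 (2 * t) (2 * k) = rule150 t k :=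
  (rule150_two_mul t k).1

theorem rule150_two_mul_odd (t : ℕ) (k : ℤ) : rule150 (2 * t) (2 * k + 1) = 0 :=
  (rule150_two_mul t k).2

theorem rule150_two_mul_add_one_even (t : ℕ) (k : ℤ) :
    rule150 (2 * t + 1) (2 * k) = rule150 t k := by
  rw [rule150, show 2 * k - 1 = 2 * (k - 1) + 1 by ring]
  simp [rule150_two_mul_even, rule150_two_mul_odd]

theorem rule150_two_mul_add_one_odd (t : ℕ) (k : ℤ) :
    rule150 (2 * t + 1) (2 * k + 1) = rule150 t k + rule150 t (k + 1) := by
  rw [rule150, show 2 * k + 1 - 1 = 2 * k by ring, show 2 * k + 1 + 1 = 2 * (k + 1) by ring]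
  simp [rule150_two_mul_even, rule150_two_mul_odd]

/-- The number of adjacent pairs of sites in different states at time `t`. -/
noncomputable def boundaryCount (t : ℕ) : ℕ :=
  {n : ℤ | rule150 t n + rule150 t (n + 1) = 1}.ncard

theorem finite_setOf_rule150_eq_one (t : ℕ) : {n : ℤ | rule150 t n = 1}.Finite := by
  refine (Set.finite_Icc (-(t : ℤ)) t).subset fun n hn => ?_
  rw [Set.mem_Icc, ← abs_le]
  by_contra! h
  simp [rule150_eq_zero_of_lt_abs t n h] at hn

theorem finite_setOf_rule150_add_eq_one (t : ℕ) :
    {n : ℤ | rule150 t n + rule150 t (n + 1) = 1}.Finite := by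
  have h := finite_setOf_rule150_eq_one t
  refine (h.union (h.preimage (add_left_injective (1 : ℤ)).injOn)).subset fun n hn => ?_
  simp only [Set.mem_ofPred_eq, Set.mem_union, Set.mem_preimage] at hn ⊢
  generalize rule150 t n = a, rule150 t (n + 1) = b at hn ⊢
  decide +revert

theorem Set.Finite.ncard_int_eq_even_add_odd {s : Set ℤ} (hs : s.Finite) :
    s.ncard = {k : ℤ | 2 * k ∈ s}.ncard + {k : ℤ | 2 * k + 1 ∈ s}.ncard := by
  have he : Function.Injective fun k : ℤ => 2 * k := fun a b h => by grind
  have ho : Function.Injective fun k : ℤ => 2 * k + 1 := fun a b h => by grind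
  rw [← Set.ncard_image_of_injective {k : ℤ | 2 * k ∈ s} he,
    ← Set.ncard_image_of_injective {k : ℤ | 2 * k + 1 ∈ s} ho,
    ← Set.ncard_union_eq ?_ (hs.subset ?_) (hs.subset ?_)]
  · congr 1
    ext n
    simp only [Set.mem_union, Set.mem_image, Set.mem_ofPred_eq]
    constructor
    · intro hn
      obtain ⟨k, rfl | rfl⟩ := Int.even_or_odd' n
      · exact Or.inl ⟨k, hn, rfl⟩
      · exact Or.inr ⟨k, hn, rfl⟩
    · rintro (⟨k, hk, rfl⟩ | ⟨k, hk, rfl⟩) <;> exact hk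
  · rw [Set.disjoint_left]
    rintro _ ⟨a, -, rfl⟩ ⟨b, -, h⟩
    grind
  · rintro _ ⟨k, hk, rfl⟩
    exact hk
  · rintro _ ⟨k, hk, rfl⟩
    exact hk

theorem ncard_setOf_rule150_add_one_eq_one (t : ℕ) :
    {k : ℤ | rule150 t (k + 1) = 1}.ncard = totalActivity t :=
  Set.ncard_preimage_of_injective_subset_range (s := {n : ℤ | rule150 t n = 1})
    (add_left_injective (1 : ℤ)) fun n _ => ⟨n - 1, by simp⟩

theorem totalActivity_two_mul (t : ℕ) : totalActivity (2 * t) = totalActivity t := by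
  rw [totalActivity, (finite_setOf_rule150_eq_one _).ncard_int_eq_even_add_odd]
  simp [rule150_two_mul_even, rule150_two_mul_odd, totalActivity]

theorem totalActivity_two_mul_add_one (t : ℕ) :
    totalActivity (2 * t + 1) = totalActivity t + boundaryCount t := by
  rw [totalActivity, (finite_setOf_rule150_eq_one _).ncard_int_eq_even_add_odd]
  simp [rule150_two_mul_add_one_even, rule150_two_mul_add_one_odd, totalActivity, boundaryCount]

theorem boundaryCount_two_mul (t : ℕ) : boundaryCount (2 * t) = 2 * totalActivity t := by
  rw [boundaryCount, (finite_setOf_rule150_add_eq_one _).ncard_int_eq_even_add_odd]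
  have h (k : ℤ) : 2 * k + 1 + 1 = 2 * (k + 1) := by ring
  simp only [Set.mem_ofPred_eq, h, rule150_two_mul_even, rule150_two_mul_odd, add_zero, zero_add]
  rw [ncard_setOf_rule150_add_one_eq_one, ← totalActivity, two_mul]

theorem boundaryCount_two_mul_add_one (t : ℕ) :
    boundaryCount (2 * t + 1) = 2 * totalActivity t := by
  rw [boundaryCount, (finite_setOf_rule150_add_eq_one _).ncard_int_eq_even_add_odd]
  have h (k : ℤ) : 2 * k + 1 + 1 = 2 * (k + 1) := by ring
  have h₁ (a b : ZMod 2) : a + (a + b) = b := by decide +revert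
  have h₂ (a b : ZMod 2) : a + b + b = a := by decide +revert
  simp only [Set.mem_ofPred_eq, h, rule150_two_mul_add_one_even, rule150_two_mul_add_one_odd,
    h₁, h₂]
  rw [ncard_setOf_rule150_add_one_eq_one, ← totalActivity, two_mul]

theorem Finset.sum_range_two_mul {M : Type*} [AddCommMonoid M] (f : ℕ → M) (m : ℕ) :
    ∑ i ∈ range (2 * m), f i = ∑ i ∈ range m, (f (2 * i) + f (2 * i + 1)) := by
  induction m with
  | zero => simp
  | succ m ih => rw [mul_add, mul_one, sum_range_succ, sum_range_succ, ih, sum_range_succ, add_assoc]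

theorem blockSum_succ (n : ℕ) :
    blockSum (n + 1) = 2 * blockSum n + ∑ i ∈ Finset.range (2 ^ n), boundaryCount i := by
  rw [blockSum, pow_succ', Finset.sum_range_two_mul]
  simp only [totalActivity_two_mul, totalActivity_two_mul_add_one, Finset.sum_add_distrib,
    blockSum]
  ring

theorem sum_boundaryCount_succ (n : ℕ) :
    ∑ i ∈ Finset.range (2 ^ (n + 1)), boundaryCount i = 4 * blockSum n := by
  rw [pow_succ', Finset.sum_range_two_mul]
  simp only [boundaryCount_two_mul, boundaryCount_two_mul_add_one, Finset.sum_add_distrib,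
    blockSum, ← Finset.mul_sum]
  ring

theorem totalActivity_zero : totalActivity 0 = 1 := by
  simp [totalActivity, rule150]

theorem boundaryCount_zero : boundaryCount 0 = 2 := by
  have h : {n : ℤ | rule150 0 n + rule150 0 (n + 1) = 1} = {0, -1} := by
    ext n
    simp only [rule150, Set.mem_ofPred_eq, Set.mem_insert_iff, Set.mem_singleton_iff]
    split_ifs <;> simp <;> omega
  rw [boundaryCount, h, Set.ncard_pair (by decide)]

theorem blockSum_eq_two_pow_mul_fib (n : ℕ) : blockSum n = 2 ^ n * Nat.fib (n + 2) := by
  suffices h : blockSum n = 2 ^ n * Nat.fib (n + 2) ∧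
      ∑ i ∈ Finset.range (2 ^ n), boundaryCount i = 2 ^ (n + 1) * Nat.fib (n + 1) from h.1
  induction n with
  | zero => simp [blockSum, totalActivity_zero, boundaryCount_zero]
  | succ n ih =>
    refine ⟨?_, ?_⟩
    · rw [blockSum_succ, ih.1, ih.2, Nat.fib_add_two (n := n + 1)]
      ring
    · rw [sum_boundaryCount_succ, ih.1]
      ring

theorem blockSum_detrended (n : ℕ) (hn : 1 ≤ n) :
    (blockSum n : ℤ) - blockSum (n - 1)
        = 2 ^ (n - 1) * (Nat.fib (n + 2) + Nat.fib n)
    ∧ ((blockSum n : ℤ) - blockSum (n - 1)) / 2 ^ (n - 1)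
        = 2 * Nat.fib (n + 2) - Nat.fib (n + 1) := by
  obtain ⟨m, rfl⟩ : ∃ m, n = m + 1 := ⟨n - 1, by omega⟩
  have h : (blockSum (m + 1) : ℤ) - blockSum m
      = 2 ^ m * (Nat.fib (m + 3) + Nat.fib (m + 1)) := by
    rw [blockSum_eq_two_pow_mul_fib, blockSum_eq_two_pow_mul_fib, Nat.fib_add_two (n := m + 1)]
    rw [Nat.fib_add_two (n := m)]
    push_cast
    ring
  rw [Nat.add_sub_cancel]
  refine ⟨h, ?_⟩
  rw [h, Int.mul_ediv_cancel_left _ (by positivity), Nat.fib_add_two (n := m + 1)]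
  push_cast
  ring
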